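/- arXiv:2605.20074 — 6 statements merged into one kernel-verified Lean document; each statement's English description precedes it below -/
import Mathlib

section
/- Let n ≥ 2 and let (D, ρ) be a partial assignment that forces f_n = 0. Then {1,n} ∈ D with ρ({1,n}) = 0, and for every v ∈ {2,…,n−1} at least one of the pairs {1,v}, {v,n} lies in D and is assigned the value 0 by ρ. Consequently |D| ≥ n − 1. -/
/-- `P_n`: unordered pairs of distinct elements of the `n`-element vertex set. -/
abbrev EdgeIx (n : ℕ) := {p : Sym2 (Fin n) // ¬ p.IsDiag}

/-- The unordered pair `{a,b}` for distinct `a b`. -/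
def mkEdge {n : ℕ} (a b : Fin n) (h : a ≠ b) : EdgeIx n := ⟨s(a,b), by simpa using h⟩

/-- Read an assignment `x : P_n → {0,1}` at an arbitrary unordered pair. -/
def xe {n : ℕ} (x : EdgeIx n → Bool) (p : Sym2 (Fin n)) : Bool :=
  if h : p.IsDiag then false else x ⟨p, h⟩

/-- Vertex `1`. -/
def vone (n : ℕ) (hn : 2 ≤ n) : Fin n := ⟨0, by omega⟩

/-- Vertex `n`. -/
def vlast (n : ℕ) (hn : 2 ≤ n) : Fin n := ⟨n - 1, by omega⟩

lemma vone_ne_vlast (n : ℕ) (hn : 2 ≤ n) : vone n hn ≠ vlast n hn := by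
  simp only [vone, vlast, Ne, Fin.mk.injEq]; omega

/-- The 2-reachability function `f_n`. -/
def fReach (n : ℕ) (hn : 2 ≤ n) (x : EdgeIx n → Bool) : Bool :=
  xe x s(vone n hn, vlast n hn) ||
    decide (∃ v : Fin n, v ≠ vone n hn ∧ v ≠ vlast n hn ∧
      xe x s(vone n hn, v) = true ∧ xe x s(v, vlast n hn) = true)

lemma xe_mk_of_ne {n : ℕ} (x : EdgeIx n → Bool) {a b : Fin n} (h : a ≠ b) :
    xe x s(a, b) = x (mkEdge a b h) := by
  simp [xe, mkEdge, h]

/-- Distinct vertices other than `a` cannot be witnessed by the same edge, where `c` is witnessed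
by `{a,c}` and any other vertex `v` by `{a,v}` or `{v,c}`. -/
lemma eq_of_sym2_witness {α : Type*} {a c v w : α} {p : Sym2 α}
    (hv : v ≠ a) (hw : w ≠ a)
    (hpv : p = s(a, v) ∨ v ≠ c ∧ p = s(v, c))
    (hpw : p = s(a, w) ∨ w ≠ c ∧ p = s(w, c)) : v = w := by
  rcases hpv with rfl | ⟨hvc, rfl⟩ <;> rcases hpw with h | ⟨hwc, h⟩ <;>
    rw [Sym2.eq_iff] at h <;> grind

/-- If a partial assignment `(D, ρ)` forces `f_n = 0`, then `{1,n} ∈ D` with value `0`,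
for every intermediate vertex `v` at least one of `{1,v}`, `{v,n}` lies in `D` with
value `0`, and consequently `|D| ≥ n − 1`. -/
theorem zero_forcing_structure (n : ℕ) (hn : 2 ≤ n)
    (D : Finset (EdgeIx n)) (ρ : EdgeIx n → Bool)
    (hforce : ∀ x : EdgeIx n → Bool, (∀ e ∈ D, x e = ρ e) → fReach n hn x = false) :
    (mkEdge (vone n hn) (vlast n hn) (vone_ne_vlast n hn) ∈ D ∧
      ρ (mkEdge (vone n hn) (vlast n hn) (vone_ne_vlast n hn)) = false) ∧
    (∀ v : Fin n, ∀ (hv1 : v ≠ vone n hn) (hvn : v ≠ vlast n hn),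
      (mkEdge (vone n hn) v (Ne.symm hv1) ∈ D ∧
        ρ (mkEdge (vone n hn) v (Ne.symm hv1)) = false) ∨
      (mkEdge v (vlast n hn) hvn ∈ D ∧
        ρ (mkEdge v (vlast n hn) hvn) = false)) ∧
    n - 1 ≤ D.card := by
  have hx := hforce (fun e => if e ∈ D then ρ e else true) (fun e he => by simp [he])
  rw [fReach, Bool.or_eq_false_iff, decide_eq_false_iff_not,
    xe_mk_of_ne _ (vone_ne_vlast n hn)] at hx
  obtain ⟨hedge, hpath⟩ := hx
  have hlast : mkEdge (vone n hn) (vlast n hn) (vone_ne_vlast n hn) ∈ D ∧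
      ρ (mkEdge (vone n hn) (vlast n hn) (vone_ne_vlast n hn)) = false := by
    simpa using hedge
  have hmid : ∀ v : Fin n, ∀ (hv1 : v ≠ vone n hn) (hvn : v ≠ vlast n hn),
      (mkEdge (vone n hn) v (Ne.symm hv1) ∈ D ∧
        ρ (mkEdge (vone n hn) v (Ne.symm hv1)) = false) ∨
      (mkEdge v (vlast n hn) hvn ∈ D ∧
        ρ (mkEdge v (vlast n hn) hvn) = false) := by
    intro v hv1 hvn
    by_contra hcon
    refine hpath ⟨v, hv1, hvn, ?_, ?_⟩
    · rw [xe_mk_of_ne _ (Ne.symm hv1)]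
      grind
    · rw [xe_mk_of_ne _ hvn]
      grind
  refine ⟨hlast, hmid, ?_⟩
  have hwit : ∀ v : Fin n, v ≠ vone n hn → ∃ e ∈ D,
      e.1 = s(vone n hn, v) ∨ v ≠ vlast n hn ∧ e.1 = s(v, vlast n hn) := by
    intro v hv1
    by_cases hvn : v = vlast n hn
    · subst hvn
      exact ⟨_, hlast.1, Or.inl rfl⟩
    · rcases hmid v hv1 hvn with h | h
      · exact ⟨_, h.1, Or.inl rfl⟩
      · exact ⟨_, h.1, Or.inr ⟨hvn, rfl⟩⟩
  have : Nonempty (EdgeIx n) := ⟨mkEdge _ _ (vone_ne_vlast n hn)⟩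
  choose! g hgD hg using hwit
  have hcard : (Finset.univ.erase (vone n hn)).card ≤ D.card := by
    refine Finset.card_le_card_of_injOn g (fun v hv => hgD v (Finset.ne_of_mem_erase hv)) ?_
    intro v hv w hw hvw
    have hv' := Finset.ne_of_mem_erase hv
    have hw' := Finset.ne_of_mem_erase hw
    exact eq_of_sym2_witness hv' hw' (hg v hv') (hvw ▸ hg w hw')
  simpa using hcard
end

section
/- Let n ≥ 2 and let (D, ρ) be a partial assignment that forces f_n = 0. Then the number of assignments x in the restricted family that extend (D, ρ) is at most 2^{n−2}; i.e., each such 'zero-forcing subcube' contains at most a 2^{−(n−1)} fraction of the 2^{2n−3} members of the restricted family. -/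
/-- `E'_n`: the pairs containing vertex `1` or vertex `n`. -/
def Estar (n : ℕ) (hn : 2 ≤ n) : Finset (EdgeIx n) :=
  Finset.univ.filter (fun e => vone n hn ∈ e.1 ∨ vlast n hn ∈ e.1)

theorem xe_mono {n : ℕ} {x y : EdgeIx n → Bool} (h : ∀ e, x e = true → y e = true)
    {p : Sym2 (Fin n)} (hp : xe y p = false) : xe x p = false := by
  unfold xe at *
  split_ifs at * with hd
  · rfl
  · specialize h ⟨p, hd⟩
    simp_all

theorem xe_coe {n : ℕ} (x : EdgeIx n → Bool) (e : EdgeIx n) : xe x e.1 = x e := by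
  simp [xe, e.2]

theorem card_inner_vertices (n : ℕ) (hn : 2 ≤ n) :
    Fintype.card {v : Fin n // v ≠ vone n hn ∧ v ≠ vlast n hn} = n - 2 := by
  have hne : vone n hn ≠ vlast n hn := by
    simp only [vone, vlast, ne_eq, Fin.mk.injEq]
    omega
  have hset : (Finset.univ.filter fun v : Fin n => v ≠ vone n hn ∧ v ≠ vlast n hn)
      = ({vone n hn, vlast n hn} : Finset (Fin n))ᶜ := by
    ext v
    simp
  rw [Fintype.card_subtype, hset, Finset.card_compl, Finset.card_pair hne, Fintype.card_fin]

/-- Two members of the restricted family lying below a common zero of `fReach` coincide as soon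
as, at every inner vertex, the disjunctions of their values on the edges to the two terminals
coincide. -/
theorem eq_of_le_zero_of_or_eq {n : ℕ} {hn : 2 ≤ n} {x y z : EdgeIx n → Bool}
    (hz : fReach n hn z = false)
    (hxz : ∀ e, x e = true → z e = true) (hyz : ∀ e, y e = true → z e = true)
    (hx : ∀ e, e ∉ Estar n hn → x e = false) (hy : ∀ e, e ∉ Estar n hn → y e = false)
    (h : ∀ v, v ≠ vone n hn → v ≠ vlast n hn →
      (xe x s(vone n hn, v) || xe x s(v, vlast n hn)) =
        (xe y s(vone n hn, v) || xe y s(v, vlast n hn))) : x = y := by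
  simp only [fReach, Bool.or_eq_false_iff, decide_eq_false_iff_not] at hz
  obtain ⟨hterm, hpath⟩ := hz
  have hinner : ∀ v, v ≠ vone n hn → v ≠ vlast n hn →
      xe x s(vone n hn, v) = xe y s(vone n hn, v) ∧
        xe x s(v, vlast n hn) = xe y s(v, vlast n hn) := by
    intro v hv1 hvn
    have hv := h v hv1 hvn
    by_cases hzv : xe z s(vone n hn, v) = true
    · have hzn : xe z s(v, vlast n hn) = false :=
        Bool.eq_false_iff.2 fun hzn => hpath ⟨v, hv1, hvn, hzv, hzn⟩
      rw [xe_mono hxz hzn, xe_mono hyz hzn] at hv ⊢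
      simpa using hv
    · have hz1 := Bool.eq_false_iff.2 hzv
      rw [xe_mono hxz hz1, xe_mono hyz hz1] at hv ⊢
      simpa using hv
  have hends : xe x s(vone n hn, vlast n hn) = xe y s(vone n hn, vlast n hn) := by
    rw [xe_mono hxz hterm, xe_mono hyz hterm]
  have hdiag : ∀ v : Fin n, xe x s(v, v) = xe y s(v, v) := by
    intro v
    simp [xe]
  funext e
  by_cases he : e ∈ Estar n hn
  · rw [← xe_coe x e, ← xe_coe y e]
    simp only [Estar, Finset.mem_filter, Finset.mem_univ, true_and] at he
    rcases he with he | he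
    · obtain ⟨v, hv⟩ := Sym2.mem_iff_exists.1 he
      rw [hv]
      by_cases hv1 : v = vone n hn
      · rw [hv1, hdiag]
      by_cases hvn : v = vlast n hn
      · rw [hvn, hends]
      exact (hinner v hv1 hvn).1
    · obtain ⟨v, hv⟩ := Sym2.mem_iff_exists.1 he
      rw [hv, Sym2.eq_swap]
      by_cases hv1 : v = vone n hn
      · rw [hv1, hends]
      by_cases hvn : v = vlast n hn
      · rw [hvn, hdiag]
      exact (hinner v hv1 hvn).2
  · rw [hx e he, hy e he]

/-- If a partial assignment `(D, ρ)` forces `f_n = 0`, then at most `2 ^ (n−2)` members of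
the restricted family extend it. -/
theorem zero_forcing_subcube_small (n : ℕ) (hn : 2 ≤ n)
    (D : Finset (EdgeIx n)) (ρ : EdgeIx n → Bool)
    (hforce : ∀ x : EdgeIx n → Bool, (∀ e ∈ D, x e = ρ e) → fReach n hn x = false) :
    ((Finset.univ : Finset (EdgeIx n → Bool)).filter
        (fun x => (∀ e : EdgeIx n, e ∉ Estar n hn → x e = false) ∧
          ∀ e ∈ D, x e = ρ e)).card ≤ 2 ^ (n - 2) := by
  have hz := hforce (fun e => if e ∈ D then ρ e else true) fun e he => if_pos he
  have hle : ∀ x : EdgeIx n → Bool, (∀ e ∈ D, x e = ρ e) →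
      ∀ e, x e = true → (if e ∈ D then ρ e else true) = true := by
    intro x hx e hxe
    split_ifs with he
    · rw [← hx e he, hxe]
    · rfl
  have hcard : (Finset.univ :
      Finset ({v : Fin n // v ≠ vone n hn ∧ v ≠ vlast n hn} → Bool)).card = 2 ^ (n - 2) := by
    rw [Finset.card_univ, Fintype.card_fun, card_inner_vertices, Fintype.card_bool]
  rw [← hcard]
  refine Finset.card_le_card_of_injOn
    (fun x v => xe x s(vone n hn, v.1) || xe x s(v.1, vlast n hn))
    (fun _ _ => Finset.mem_coe.2 (Finset.mem_univ _)) ?_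
  intro x hx y hy hxy
  simp only [Finset.coe_filter, Finset.mem_univ, true_and, Set.mem_ofPred_eq] at hx hy
  exact eq_of_le_zero_of_or_eq hz (hle x hx.2) (hle y hy.2) hx.1 hy.1
    fun v hv1 hvn => congrFun hxy ⟨v, hv1, hvn⟩
end

section
/- Let V be a finite-dimensional real inner product space, let P : V → V be an orthogonal projection (a linear idempotent self-adjoint map), let c ≥ 0, and let f_1,…,f_N ∈ V be such that P f_1,…,P f_N are pairwise orthogonal and ‖P f_i‖² ≥ c for every i. Then the Gram matrix G with entries G_{ij} = ⟨f_i, f_j⟩ satisfies det G ≥ c^N. -/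
open RealInnerProductSpace

/-- If `A - c • 1` is positive semidefinite, then every eigenvalue of `A` is at least `c`. -/
lemma Matrix.IsHermitian.le_eigenvalues_of_posSemidef_sub_smul_one {n : Type*} [Fintype n]
    [DecidableEq n] {A : Matrix n n ℝ} (hA : A.IsHermitian) {c : ℝ}
    (h : (A - c • (1 : Matrix n n ℝ)).PosSemidef) (i : n) : c ≤ hA.eigenvalues i := by
  have hv : star ⇑(hA.eigenvectorBasis i) ⬝ᵥ ⇑(hA.eigenvectorBasis i) = 1 := by
    have h1 := hA.eigenvectorBasis.orthonormal.1 i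
    have h2 := EuclideanSpace.real_norm_sq_eq (hA.eigenvectorBasis i)
    rw [h1] at h2
    simpa [dotProduct, pow_two] using h2.symm
  have hq := h.dotProduct_mulVec_nonneg ⇑(hA.eigenvectorBasis i)
  rw [Matrix.sub_mulVec, hA.mulVec_eigenvectorBasis, Matrix.smul_mulVec, Matrix.one_mulVec,
    dotProduct_sub, dotProduct_smul, dotProduct_smul, hv] at hq
  simpa using hq

/-- If `c ≥ 0` and `A - c • 1` is positive semidefinite, then `c ^ n ≤ det A`. -/
lemma Matrix.IsHermitian.pow_card_le_det {n : Type*} [Fintype n] [DecidableEq n]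
    {A : Matrix n n ℝ} (hA : A.IsHermitian) {c : ℝ} (hc : 0 ≤ c)
    (h : (A - c • (1 : Matrix n n ℝ)).PosSemidef) : c ^ Fintype.card n ≤ A.det := by
  rw [hA.det_eq_prod_eigenvalues, ← Finset.card_univ, ← Finset.prod_const]
  exact Finset.prod_le_prod (fun _ _ ↦ hc)
    fun i _ ↦ hA.le_eigenvalues_of_posSemidef_sub_smul_one h i

/-- Lower bound on a Gram determinant via an orthogonal projection: if `P` is an
orthogonal projection (idempotent and self-adjoint), the projections `P f_i` are
pairwise orthogonal, and `‖P f_i‖² ≥ c` for all `i`, then the Gram matrix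
`G_{ij} = ⟨f_i, f_j⟩` satisfies `det G ≥ c^N`. -/
theorem gram_det_lower_bound {V : Type*} [NormedAddCommGroup V]
    [InnerProductSpace ℝ V] [FiniteDimensional ℝ V] {N : ℕ}
    (P : V →ₗ[ℝ] V) (hidem : P ∘ₗ P = P)
    (hsa : ∀ u v : V, ⟪P u, v⟫ = ⟪u, P v⟫)
    (c : ℝ) (hc : 0 ≤ c) (f : Fin N → V)
    (horth : ∀ i j : Fin N, i ≠ j → ⟪P (f i), P (f j)⟫ = 0)
    (hnorm : ∀ i : Fin N, c ≤ ‖P (f i)‖ ^ 2) :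
    c ^ N ≤ (Matrix.of fun i j : Fin N => ⟪f i, f j⟫).det := by
  have hdecomp : Matrix.gram ℝ f - c • (1 : Matrix (Fin N) (Fin N) ℝ) =
      Matrix.gram ℝ (fun i ↦ f i - P (f i)) + Matrix.diagonal fun i ↦ ‖P (f i)‖ ^ 2 - c := by
    have hP (u v : V) : ⟪P u, P v⟫ = ⟪u, P v⟫ := by
      rw [hsa, ← LinearMap.comp_apply, hidem]
    have hgram (u v : V) : ⟪u - P u, v - P v⟫ = ⟪u, v⟫ - ⟪P u, P v⟫ := by
      simp only [inner_sub_left, inner_sub_right, hP, hsa]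
      ring
    ext i j
    rcases eq_or_ne i j with rfl | hij
    · simp [Matrix.gram_apply, hgram, ← real_inner_self_eq_norm_sq, -inner_self_eq_norm_sq_to_K]
    · simp [Matrix.gram_apply, hgram, hij, horth i j hij]
  have hpsd : (Matrix.gram ℝ f - c • (1 : Matrix (Fin N) (Fin N) ℝ)).PosSemidef :=
    hdecomp ▸ (Matrix.posSemidef_gram ℝ _).add
      (Matrix.PosSemidef.diagonal fun i ↦ sub_nonneg.2 (hnorm i))
  simpa [Matrix.gram] using (Matrix.isHermitian_gram ℝ f).pow_card_le_det hc hpsd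
end

section
/- Let φ : {−1,1}^d → ℝ^m, let (A, σ) be a non-degenerate k-clause, and let w ∈ ℝ^m with ‖w‖ ≤ τ be such that ⟨w, φ(x)⟩ = AND_{A,σ}(x) for every x ∈ {−1,1}^d (exact linear representation of the conjunction). Then τ² · 𝔼_x‖φ(x)‖² ≥ 2^{−k}, where the expectation is over the uniform distribution on {−1,1}^d. -/
open Finset RealInnerProductSpace

/-- The conjunction `AND_{A,σ}` of the non-degenerate clause `(A, σ)` over `{−1,1}^d`,
identified with `Fin d → Bool`: it is `1` iff `x_i = σ(i)` for all `i ∈ A`. -/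
def andClause {d : ℕ} (A : Finset (Fin d)) (σ : Fin d → Bool) (x : Fin d → Bool) : ℝ :=
  if ∀ i ∈ A, x i = σ i then 1 else 0

/-- The number of points of the cube satisfying a clause on `A` is `2 ^ (d - |A|)`. -/
theorem sum_andClause_mul_two_pow_card {d : ℕ} (A : Finset (Fin d)) (σ : Fin d → Bool) :
    (∑ x : Fin d → Bool, andClause A σ x) * 2 ^ A.card = 2 ^ d := by
  have hset : univ.filter (fun x : Fin d → Bool => ∀ i ∈ A, x i = σ i) =
      Fintype.piFinset fun i => if i ∈ A then {σ i} else univ := by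
    ext x
    simp only [mem_filter, mem_univ, true_and, Fintype.mem_piFinset]
    refine forall_congr' fun i => ?_
    by_cases hi : i ∈ A <;> simp [hi]
  have hcard : (univ.filter fun x : Fin d → Bool => ∀ i ∈ A, x i = σ i).card =
      2 ^ Aᶜ.card := by
    rw [hset, Fintype.card_piFinset, ← prod_mul_prod_compl A]
    rw [prod_congr rfl (g := fun _ => 1) fun i hi => by simp [hi],
      prod_congr (s₁ := Aᶜ) rfl (g := fun _ => 2) fun i hi => by simp [mem_compl.mp hi]]
    simp
  simp only [andClause, sum_boole]
  rw [hcard]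
  push_cast
  rw [← pow_add, card_compl_add_card, Fintype.card_fin]

/-- A readout of norm at most `τ` computing the clause satisfies `AND(x) ≤ τ² ‖φ(x)‖²`. -/
theorem andClause_le_of_inner_eq {d : ℕ} {E : Type*} [NormedAddCommGroup E]
    [InnerProductSpace ℝ E] {A : Finset (Fin d)} {σ x : Fin d → Bool} {τ : ℝ} {w v : E}
    (hw : ‖w‖ ≤ τ) (h : ⟪w, v⟫ = andClause A σ x) :
    andClause A σ x ≤ τ ^ 2 * ‖v‖ ^ 2 := by
  have hsq : andClause A σ x = |⟪w, v⟫| ^ 2 := by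
    rw [h]
    unfold andClause
    split_ifs <;> simp
  rw [hsq, ← mul_pow]
  gcongr
  exact (abs_real_inner_le_norm w v).trans (by gcongr)

/-- If a low-norm linear readout of the representation `φ` exactly computes the
conjunction of a non-degenerate `k`-clause, then `τ² 𝔼_x ‖φ(x)‖² ≥ 2^{−k}`. -/
theorem exact_representation_norm_lower_bound {d m k : ℕ}
    (φ : (Fin d → Bool) → EuclideanSpace ℝ (Fin m))
    (A : Finset (Fin d)) (σ : Fin d → Bool) (hA : A.card = k)
    (τ : ℝ) (w : EuclideanSpace ℝ (Fin m)) (hw : ‖w‖ ≤ τ)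
    (hrep : ∀ x : Fin d → Bool, ⟪w, φ x⟫ = andClause A σ x) :
    (1 : ℝ) / 2 ^ k ≤ τ ^ 2 * ((∑ x : Fin d → Bool, ‖φ x‖ ^ 2) / 2 ^ d) := by
  have hsum : ∑ x : Fin d → Bool, andClause A σ x ≤ τ ^ 2 * ∑ x, ‖φ x‖ ^ 2 := by
    rw [mul_sum]
    exact sum_le_sum fun x _ => andClause_le_of_inner_eq hw (hrep x)
  have hcount := sum_andClause_mul_two_pow_card A σ
  rw [hA] at hcount
  rw [← mul_div_assoc, div_le_div_iff₀ (by positivity) (by positivity), one_mul, ← hcount]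
  gcongr
end

section
/- Let φ : {−1,1}^d → ℝ^m, let (A, σ) be a non-degenerate k-clause, and let w ∈ ℝ^m with ‖w‖ ≤ τ be such that 𝔼_x[(⟨w, φ(x)⟩ − AND_{A,σ}(x))²] ≤ 2^{−k−2} (approximate linear representation of the conjunction). Then τ² · 𝔼_x‖φ(x)‖² ≥ 2^{−k−2}, where the expectation is over the uniform distribution on {−1,1}^d. -/
open Finset RealInnerProductSpace

/-- A clause on `A` is satisfied by exactly `2 ^ (d - |A|)` points of the cube. -/
theorem sum_andClause_sq_mul {d : ℕ} (A : Finset (Fin d)) (σ : Fin d → Bool) :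
    (∑ x : Fin d → Bool, andClause A σ x ^ 2) * 2 ^ A.card = 2 ^ d := by
  have hset : (univ.filter fun x : Fin d → Bool => ∀ i ∈ A, x i = σ i)
      = Fintype.piFinset fun i => if i ∈ A then {σ i} else univ := by
    ext x
    simp only [mem_filter, mem_univ, true_and, Fintype.mem_piFinset]
    refine forall_congr' fun i => ?_
    by_cases hi : i ∈ A <;> simp [hi]
  have hcard : (univ.filter fun x : Fin d → Bool => ∀ i ∈ A, x i = σ i).card
      = 2 ^ Aᶜ.card := by
    rw [hset, Fintype.card_piFinset]
    simp only [apply_ite Finset.card, card_singleton, card_univ, Fintype.card_bool]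
    rw [prod_ite, prod_const_one, one_mul, prod_const]
    congr 2
    ext i
    simp
  have hsum : ∑ x : Fin d → Bool, andClause A σ x ^ 2 = 2 ^ Aᶜ.card := by
    simp only [andClause, ite_pow, one_pow, ne_eq, OfNat.ofNat_ne_zero, not_false_eq_true,
      zero_pow, sum_boole, hcard]
    norm_num
  rw [hsum, ← pow_add, card_compl_add_card, Fintype.card_fin]

/-- If a low-norm linear readout of the representation `φ` approximates the conjunction
of a non-degenerate `k`-clause to squared error at most `2^{−k−2}` (in expectation over
the uniform distribution), then `τ² 𝔼_x ‖φ(x)‖² ≥ 2^{−k−2}`. -/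
theorem approx_representation_norm_lower_bound {d m k : ℕ}
    (φ : (Fin d → Bool) → EuclideanSpace ℝ (Fin m))
    (A : Finset (Fin d)) (σ : Fin d → Bool) (hA : A.card = k)
    (τ : ℝ) (w : EuclideanSpace ℝ (Fin m)) (hw : ‖w‖ ≤ τ)
    (hrep : (∑ x : Fin d → Bool, (⟪w, φ x⟫ - andClause A σ x) ^ 2) / 2 ^ d
      ≤ (1 : ℝ) / 2 ^ (k + 2)) :
    (1 : ℝ) / 2 ^ (k + 2) ≤ τ ^ 2 * ((∑ x : Fin d → Bool, ‖φ x‖ ^ 2) / 2 ^ d) := by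
  have hand : (∑ x : Fin d → Bool, andClause A σ x ^ 2) / 2 ^ d = 1 / 2 ^ k := by
    rw [div_eq_div_iff (by positivity) (by positivity), ← hA, sum_andClause_sq_mul, one_mul]
  have hsplit : ∑ x : Fin d → Bool, andClause A σ x ^ 2
      ≤ 2 * ∑ x, ⟪w, φ x⟫ ^ 2 + 2 * ∑ x, (⟪w, φ x⟫ - andClause A σ x) ^ 2 := by
    rw [mul_sum, mul_sum, ← sum_add_distrib]
    refine sum_le_sum fun x _ => ?_
    nlinarith [sq_nonneg (2 * ⟪w, φ x⟫ - andClause A σ x)]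
  have hcs : ∑ x, ⟪w, φ x⟫ ^ 2 ≤ τ ^ 2 * ∑ x, ‖φ x‖ ^ 2 := by
    rw [mul_sum]
    refine sum_le_sum fun x _ => ?_
    rw [← mul_pow, ← sq_abs]
    gcongr
    exact (abs_real_inner_le_norm w (φ x)).trans (by gcongr)
  have hmain : (∑ x : Fin d → Bool, andClause A σ x ^ 2) / 2 ^ d
      ≤ 2 * (τ ^ 2 * ((∑ x, ‖φ x‖ ^ 2) / 2 ^ d))
        + 2 * ((∑ x, (⟪w, φ x⟫ - andClause A σ x) ^ 2) / 2 ^ d) := by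
    rw [← mul_div_assoc, ← mul_div_assoc, ← mul_div_assoc, ← add_div]
    gcongr
    linarith
  have hpow : (1 : ℝ) / 2 ^ k = 4 * (1 / 2 ^ (k + 2)) := by
    field_simp
    ring
  linarith
end

section
/- Let φ : {−1,1}^d → ℝ^m and let (A_1, σ_1),…,(A_N, σ_N) be non-degenerate clauses over {−1,1}^d whose variable sets A_1,…,A_N are pairwise distinct. If for every i there exists w_i ∈ ℝ^m with ⟨w_i, φ(x)⟩ = AND_{A_i,σ_i}(x) for all x ∈ {−1,1}^d, then N ≤ m: a representation of dimension m can exactly linearly represent at most m conjunctions with distinct variable sets. -/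
open RealInnerProductSpace

/-- The parity character of a set of coordinates. -/
def parity {d : ℕ} (B : Finset (Fin d)) (x : Fin d → Bool) : ℝ :=
  ∏ i ∈ B, if x i then 1 else -1

lemma parity_update_not {d : ℕ} {B : Finset (Fin d)} {b : Fin d} (hb : b ∈ B)
    (x : Fin d → Bool) : parity B (Function.update x b (!x b)) = -parity B x := by
  unfold parity
  rw [← Finset.mul_prod_erase B _ hb, ← Finset.mul_prod_erase B _ hb, ← neg_mul]
  congr 1
  · cases h : x b <;> simp
  · refine Finset.prod_congr rfl fun i hi => ?_
    rw [Function.update_of_ne (Finset.ne_of_mem_erase hi)]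

lemma andClause_update {d : ℕ} {A : Finset (Fin d)} {b : Fin d} (hb : b ∉ A)
    (σ x : Fin d → Bool) (v : Bool) :
    andClause A σ (Function.update x b v) = andClause A σ x := by
  have h : (∀ i ∈ A, Function.update x b v i = σ i) ↔ ∀ i ∈ A, x i = σ i :=
    forall₂_congr fun i hi => by
      rw [Function.update_of_ne (ne_of_mem_of_not_mem hi hb)]
  simp only [andClause, h]

/-- A conjunction is uncorrelated with every parity not supported on its variables. -/
lemma sum_parity_mul_andClause_eq_zero {d : ℕ} {A B : Finset (Fin d)} (hBA : ¬ B ⊆ A)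
    (σ : Fin d → Bool) : ∑ x, parity B x * andClause A σ x = 0 := by
  obtain ⟨b, hB, hA⟩ := Finset.not_subset.mp hBA
  refine Finset.sum_involution (fun x _ => Function.update x b (!x b)) ?_ ?_ ?_ ?_
  · intro x _
    rw [parity_update_not hB, andClause_update hA]
    ring
  · intro x _ _ h
    simpa using congrFun h b
  · simp
  · simp

/-- A conjunction is correlated with the parity of its variables. -/
lemma sum_parity_mul_andClause_ne_zero {d : ℕ} (A : Finset (Fin d)) (σ : Fin d → Bool) :
    ∑ x, parity A x * andClause A σ x ≠ 0 := by
  have h : ∀ x, parity A x * andClause A σ x = parity A σ * andClause A σ x := by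
    intro x
    by_cases hx : ∀ i ∈ A, x i = σ i
    · have : parity A x = parity A σ :=
        Finset.prod_congr rfl fun i hi => by rw [hx i hi]
      rw [this]
    · simp [andClause, hx]
  simp only [h, ← Finset.mul_sum]
  refine mul_ne_zero (Finset.prod_ne_zero_iff.mpr fun i _ => by split <;> norm_num) ?_
  refine (Finset.sum_pos' (fun x _ => ?_) ⟨σ, Finset.mem_univ _, ?_⟩).ne'
  · unfold andClause
    split <;> norm_num
  · simp [andClause]

/-- Conjunctions with pairwise distinct variable sets are linearly independent. -/
lemma linearIndependent_andClause {d : ℕ} {ι : Type*} [Fintype ι]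
    (A : ι → Finset (Fin d)) (σ : ι → Fin d → Bool) (hdist : Function.Injective A) :
    LinearIndependent ℝ fun i => andClause (A i) (σ i) := by
  classical
  rw [Fintype.linearIndependent_iff]
  intro c hc
  by_contra! hne
  obtain ⟨k, hk⟩ := hne
  obtain ⟨j, hj, hmax⟩ := Finset.exists_max_image
    (Finset.univ.filter fun i => c i ≠ 0) (fun i => (A i).card) ⟨k, by simpa using hk⟩
  simp only [Finset.mem_filter, Finset.mem_univ, true_and] at hj hmax
  have key : ∑ i, c i * ∑ x, parity (A j) x * andClause (A i) (σ i) x = 0 := by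
    simp only [Finset.mul_sum]
    rw [Finset.sum_comm]
    refine Finset.sum_eq_zero fun x _ => ?_
    have hx := congrFun hc x
    simp only [Finset.sum_apply, Pi.smul_apply, smul_eq_mul, Pi.zero_apply] at hx
    simp only [mul_left_comm (c _), ← Finset.mul_sum, hx, mul_zero]
  rw [Finset.sum_eq_single j] at key
  · exact mul_ne_zero hj (sum_parity_mul_andClause_ne_zero _ _) key
  · intro i _ hij
    by_cases hi : c i = 0
    · simp [hi]
    · rw [sum_parity_mul_andClause_eq_zero, mul_zero]
      intro hsub
      exact hij (hdist (Finset.eq_of_subset_of_card_le hsub (hmax i hi)).symm)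
  · simp

/-- An `m`-dimensional representation can exactly linearly represent at most `m`
conjunctions with pairwise distinct variable sets. -/
theorem representation_dimension_bound {d m N : ℕ}
    (φ : (Fin d → Bool) → EuclideanSpace ℝ (Fin m))
    (A : Fin N → Finset (Fin d)) (σ : Fin N → Fin d → Bool)
    (hdist : Function.Injective A)
    (hrep : ∀ i : Fin N, ∃ w : EuclideanSpace ℝ (Fin m),
      ∀ x : Fin d → Bool, ⟪w, φ x⟫ = andClause (A i) (σ i) x) :
    N ≤ m := by
  choose w hw using hrep
  have hlin : LinearIndependent ℝ w := by
    rw [Fintype.linearIndependent_iff]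
    intro c hc
    refine Fintype.linearIndependent_iff.mp (linearIndependent_andClause A σ hdist) c ?_
    funext x
    have hx : ⟪∑ i, c i • w i, φ x⟫ = 0 := by rw [hc, inner_zero_left]
    simpa [sum_inner, real_inner_smul_left, hw] using hx
  simpa using hlin.fintype_card_le_finrank
end
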